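/- arXiv:1201.4285 — 2 statements merged into one kernel-verified Lean document; each statement's English description precedes it below -/
import Mathlib

section
/- (Idempotence) Let q > 0 with q ≠ 1, let X be a finite set, let r be a strictly positive probability mass function on X, and let C be a set of strictly positive probability mass functions on X. If p ∈ C attains the minimum of I_q(·‖r) over C, then p is the unique pmf in C attaining the minimum of I_q(·‖p) over C; that is, taking the same information into account twice has the same effect as taking it into account once. -/
/-- The q-logarithm: `ln_q x = (x^(1-q) - 1)/(1-q)`. -/
noncomputable def qlog (q x : ℝ) : ℝ := (x ^ (1 - q) - 1) / (1 - q)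

/-- The Tsallis divergence `I_q(p‖r) = -∑_x p x * ln_q (r x / p x)`. -/
noncomputable def tsallisDiv {X : Type*} [Fintype X] (q : ℝ) (p r : X → ℝ) : ℝ :=
  - ∑ x, p x * qlog q (r x / p x)

theorem qlog_one (q : ℝ) : qlog q 1 = 0 := by
  simp [qlog]

/-- The graph of `qlog q` lies strictly below its tangent line at `1`, away from `1`. -/
theorem qlog_lt_sub_one {q y : ℝ} (hq0 : 0 < q) (hq1 : q ≠ 1) (hy : 0 < y) (hy1 : y ≠ 1) :
    qlog q y < y - 1 := by
  unfold qlog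
  rcases lt_or_gt_of_ne hq1 with h | h
  · rw [div_lt_iff₀ (by linarith)]
    have := rpow_one_add_lt_one_add_mul_self (s := y - 1) (by linarith) (sub_ne_zero.2 hy1)
      (p := 1 - q) (by linarith) (by linarith)
    rw [add_sub_cancel] at this
    linarith
  · rw [div_lt_iff_of_neg (by linarith)]
    have hB := one_add_mul_self_lt_rpow_one_add (s := y⁻¹ - 1)
      (by linarith [inv_pos.2 hy]) (sub_ne_zero.2 (by simpa using hy1)) h
    rw [add_sub_cancel, Real.inv_rpow hy.le] at hB
    have hM := mul_lt_mul_of_pos_left hB hy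
    have hpow : y ^ (1 - q) = y * (y ^ q)⁻¹ := by
      rw [Real.rpow_sub hy, Real.rpow_one, div_eq_mul_inv]
    have hlin : y * (1 + q * (y⁻¹ - 1)) = y + q * (1 - y) := by
      field_simp
    rw [hpow]
    linarith

theorem qlog_le_sub_one {q y : ℝ} (hq0 : 0 < q) (hq1 : q ≠ 1) (hy : 0 < y) :
    qlog q y ≤ y - 1 := by
  rcases eq_or_ne y 1 with rfl | hy1
  · simp [qlog_one]
  · exact (qlog_lt_sub_one hq0 hq1 hy hy1).le

theorem tsallisDiv_self {X : Type*} [Fintype X] (q : ℝ) {p : X → ℝ} (hp : ∀ x, 0 < p x) :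
    tsallisDiv q p p = 0 := by
  simp [tsallisDiv, div_self (hp _).ne', qlog_one]

theorem tsallisDiv_pos {X : Type*} [Fintype X] {q : ℝ} (hq0 : 0 < q) (hq1 : q ≠ 1)
    {s p : X → ℝ} (hs : ∀ x, 0 < s x) (hp : ∀ x, 0 < p x) (hsum : ∑ x, s x = ∑ x, p x)
    (hne : s ≠ p) : 0 < tsallisDiv q s p := by
  obtain ⟨x₀, hx₀⟩ := Function.ne_iff.1 hne
  have hmul (x : X) : s x * (p x / s x - 1) = p x - s x := by
    rw [mul_sub, mul_div_cancel₀ _ (hs x).ne', mul_one]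
  have hlt : ∑ x, s x * qlog q (p x / s x) < ∑ x, (p x - s x) := by
    refine Finset.sum_lt_sum (fun x _ ↦ ?_) ⟨x₀, Finset.mem_univ _, ?_⟩
    · rw [← hmul]
      exact mul_le_mul_of_nonneg_left (qlog_le_sub_one hq0 hq1 (div_pos (hp x) (hs x))) (hs x).le
    · rw [← hmul]
      refine mul_lt_mul_of_pos_left
        (qlog_lt_sub_one hq0 hq1 (div_pos (hp x₀) (hs x₀)) fun h ↦ hx₀ ?_) (hs x₀)
      exact ((div_eq_one_iff_eq (hs x₀).ne').1 h).symm
  rw [Finset.sum_sub_distrib, hsum, sub_self] at hlt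
  exact neg_pos.2 hlt

/-- Idempotence: taking the same information into account twice has the same effect as taking
it into account once. -/
theorem tsallisDiv_idempotent {X : Type*} [Fintype X] (q : ℝ) (hq0 : 0 < q) (hq1 : q ≠ 1)
    (r : X → ℝ) (hr : ∀ x, 0 < r x) (hrsum : ∑ x, r x = 1)
    (C : Set (X → ℝ))
    (hCpmf : ∀ s ∈ C, (∀ x, 0 < s x) ∧ (∑ x, s x = 1))
    (p : X → ℝ) (hp : p ∈ C)
    (hmin : ∀ s ∈ C, tsallisDiv q p r ≤ tsallisDiv q s r) :
    (∀ s ∈ C, tsallisDiv q p p ≤ tsallisDiv q s p) ∧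
    (∀ s ∈ C, (∀ t ∈ C, tsallisDiv q s p ≤ tsallisDiv q t p) → s = p) := by
  have hself := tsallisDiv_self q (hCpmf p hp).1
  have hpos (s : X → ℝ) (hs : s ∈ C) (hne : s ≠ p) : 0 < tsallisDiv q s p :=
    tsallisDiv_pos hq0 hq1 (hCpmf s hs).1 (hCpmf p hp).1
      ((hCpmf s hs).2.trans (hCpmf p hp).2.symm) hne
  refine ⟨fun s hs ↦ ?_, fun s hs hsmin ↦ ?_⟩
  · rcases eq_or_ne s p with rfl | hne
    · exact le_rfl
    · exact hself.trans_le (hpos s hs hne).le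
  · by_contra hne
    exact ((hsmin p hp).trans_eq hself).not_gt (hpos s hs hne)
end

section
/- (Subset Aggregation) Let q > 0 with q ≠ 1, let X be a finite set partitioned into nonempty blocks S₁, …, Sₙ, and let r be a strictly positive probability mass function on X. Let w₁, …, w_M : X → ℝ be functions each of which is constant on every block Sᵢ, and let C = {p : p a strictly positive pmf on X with ∑_x p(x) w_m(x) = a_m for m = 1,…,M} be nonempty. If p* attains the minimum of I_q(·‖r) over C, then for every block Sᵢ the conditional distributions of p* and r on Sᵢ coincide, i.e. p*(x)/∑_{y∈Sᵢ} p*(y) = r(x)/∑_{y∈Sᵢ} r(y) for all x ∈ Sᵢ, and I_q(p*‖r) = −∑ᵢ uᵢ ln_q(sᵢ/uᵢ), where uᵢ = ∑_{x∈Sᵢ} p*(x) and sᵢ = ∑_{x∈Sᵢ} r(x). -/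
/-- The Tsallis divergence restricted to a finite subset `S`:
`I_q(p‖r) = -∑_{x ∈ S} p x * ln_q (r x / p x)`. -/
noncomputable def tsallisDivOn {X : Type*} (q : ℝ) (S : Finset X) (p r : X → ℝ) : ℝ :=
  - ∑ x ∈ S, p x * qlog q (r x / p x)

theorem hasDerivAt_qlog {q x : ℝ} (hq : q ≠ 1) (hx : 0 < x) :
    HasDerivAt (qlog q) (x ^ (-q)) x := by
  have h1 : 1 - q ≠ 0 := sub_ne_zero.2 hq.symm
  have h := ((Real.hasDerivAt_rpow_const (p := 1 - q) (Or.inl hx.ne')).sub_const 1).div_const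
    (1 - q)
  rwa [mul_div_cancel_left₀ _ h1, show 1 - q - 1 = -q by ring] at h

theorem strictConcaveOn_qlog {q : ℝ} (hq0 : 0 < q) (hq1 : q ≠ 1) :
    StrictConcaveOn ℝ (Set.Ioi 0) (qlog q) := by
  refine StrictAntiOn.strictConcaveOn_of_deriv (convex_Ioi 0)
    (fun x hx => (hasDerivAt_qlog hq1 hx).continuousAt.continuousWithinAt) ?_
  rw [interior_Ioi]
  intro x hx y hy hxy
  rw [(hasDerivAt_qlog hq1 hx).deriv, (hasDerivAt_qlog hq1 hy).deriv]
  exact Real.rpow_lt_rpow_of_neg hx hxy (neg_neg_of_pos hq0)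

/-- The weighted log-sum inequality for `qlog`, together with its equality case. -/
theorem sum_mul_qlog_le_and_eq_iff {X : Type*} {q : ℝ} (hq0 : 0 < q) (hq1 : q ≠ 1)
    {T : Finset X} (hT : T.Nonempty) {p r : X → ℝ} (hp : ∀ x ∈ T, 0 < p x)
    (hr : ∀ x ∈ T, 0 < r x) :
    ∑ x ∈ T, p x * qlog q (r x / p x) ≤
        (∑ x ∈ T, p x) * qlog q ((∑ x ∈ T, r x) / ∑ x ∈ T, p x) ∧
      (∑ x ∈ T, p x * qlog q (r x / p x) =
          (∑ x ∈ T, p x) * qlog q ((∑ x ∈ T, r x) / ∑ x ∈ T, p x) ↔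
        ∀ x ∈ T, r x / p x = (∑ y ∈ T, r y) / ∑ y ∈ T, p y) := by
  have hu : 0 < ∑ x ∈ T, p x := Finset.sum_pos hp hT
  set u := ∑ x ∈ T, p x
  have hw : ∀ x ∈ T, 0 < p x / u := fun x hx => div_pos (hp x hx) hu
  have hwsum : ∑ x ∈ T, p x / u = 1 := by rw [← Finset.sum_div, div_self hu.ne']
  have hmem : ∀ x ∈ T, r x / p x ∈ Set.Ioi (0 : ℝ) := fun x hx => div_pos (hr x hx) (hp x hx)
  have hmean : ∑ x ∈ T, (p x / u) • (r x / p x) = (∑ x ∈ T, r x) / u := by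
    rw [Finset.sum_div]
    refine Finset.sum_congr rfl fun x hx => ?_
    have := (hp x hx).ne'
    rw [smul_eq_mul]
    field_simp
  have hval : ∑ x ∈ T, (p x / u) • qlog q (r x / p x) =
      (∑ x ∈ T, p x * qlog q (r x / p x)) / u := by
    rw [Finset.sum_div]
    exact Finset.sum_congr rfl fun x _ => by rw [smul_eq_mul]; ring
  have hconc := strictConcaveOn_qlog hq0 hq1
  have hle := hconc.concaveOn.le_map_sum (fun x hx => (hw x hx).le) hwsum hmem
  have heq := hconc.map_sum_eq_iff hw hwsum hmem
  rw [hmean, hval] at hle heq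
  refine ⟨by rwa [div_le_iff₀' hu] at hle, ?_⟩
  rw [← heq, eq_comm (a := qlog q _), div_eq_iff hu.ne', mul_comm u]

/-- A sum over a finite type can be computed block by block along a partition. -/
theorem sum_univ_eq_sum_blocks {X ι : Type*} [Fintype X] [Fintype ι] {S : ι → Finset X}
    (hdisj : ∀ i j, i ≠ j → Disjoint (S i) (S j)) (hcover : ∀ x, ∃ i, x ∈ S i) (f : X → ℝ) :
    ∑ x, f x = ∑ i, ∑ x ∈ S i, f x := by
  classical
  rw [← Finset.sum_biUnion fun i _ j _ h => hdisj i j h]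
  exact Finset.sum_congr (by ext x; simpa using hcover x) fun _ _ => rfl

/-- Redistributing the block masses of `p` inside every block proportionally to `r`. -/
theorem exists_proportional_on_blocks {X ι : Type*} {S : ι → Finset X}
    (hne : ∀ i, (S i).Nonempty) (hdisj : ∀ i j, i ≠ j → Disjoint (S i) (S j))
    (hcover : ∀ x, ∃ i, x ∈ S i) {p r : X → ℝ} (hp : ∀ x, 0 < p x) (hr : ∀ x, 0 < r x) :
    ∃ p' : X → ℝ, (∀ x, 0 < p' x) ∧ (∀ i, ∑ x ∈ S i, p' x = ∑ x ∈ S i, p x) ∧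
      ∀ i, ∀ x ∈ S i, r x / p' x = (∑ y ∈ S i, r y) / ∑ y ∈ S i, p y := by
  choose b hb using hcover
  have hb_eq : ∀ i, ∀ x ∈ S i, b x = i := fun i x hx => by
    by_contra h
    exact Finset.disjoint_left.1 (hdisj _ _ h) (hb x) hx
  have hpos : ∀ {f : X → ℝ}, (∀ x, 0 < f x) → ∀ i, 0 < ∑ y ∈ S i, f y := fun hf i =>
    Finset.sum_pos (fun x _ => hf x) (hne i)
  refine ⟨fun x => (∑ y ∈ S (b x), p y) * r x / ∑ y ∈ S (b x), r y,
    fun x => div_pos (mul_pos (hpos hp _) (hr x)) (hpos hr _), fun i => ?_, fun i x hx => ?_⟩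
  · trans ∑ x ∈ S i, (∑ y ∈ S i, p y) * r x / ∑ y ∈ S i, r y
    · exact Finset.sum_congr rfl fun x hx => by simp only [hb_eq i x hx]
    · rw [← Finset.sum_div, ← Finset.mul_sum, mul_div_cancel_right₀ _ (hpos hr i).ne']
  · have := hpos hp i
    have := hpos hr i
    have := hr x
    simp only [hb_eq i x hx]
    field_simp

/-- Subset aggregation: if the constraint functions are constant on the blocks of a partition,
then the minimizer of the Tsallis divergence has the same conditional distributions as the
prior on each block, and the divergence equals the divergence of the aggregated
distributions. -/
theorem subset_aggregation {X : Type*} [Fintype X] {n : ℕ} (S : Fin n → Finset X)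
    (hne : ∀ i, (S i).Nonempty)
    (hdisj : ∀ i j, i ≠ j → Disjoint (S i) (S j))
    (hcover : ∀ x : X, ∃ i, x ∈ S i)
    (q : ℝ) (hq0 : 0 < q) (hq1 : q ≠ 1)
    (r : X → ℝ) (hr : ∀ x, 0 < r x) (hrsum : ∑ x, r x = 1)
    {M : ℕ} (w : Fin M → X → ℝ) (a : Fin M → ℝ)
    (hwconst : ∀ m : Fin M, ∀ i, ∀ x ∈ S i, ∀ y ∈ S i, w m x = w m y)
    (hCne : ∃ p : X → ℝ, (∀ x, 0 < p x) ∧ (∑ x, p x = 1) ∧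
      (∀ m, ∑ x, p x * w m x = a m))
    (pstar : X → ℝ) (hps : ∀ x, 0 < pstar x) (hpssum : ∑ x, pstar x = 1)
    (hpsa : ∀ m, ∑ x, pstar x * w m x = a m)
    (hmin : ∀ p : X → ℝ, (∀ x, 0 < p x) → (∑ x, p x = 1) →
      (∀ m, ∑ x, p x * w m x = a m) →
      tsallisDivOn q Finset.univ pstar r ≤ tsallisDivOn q Finset.univ p r) :
    (∀ i, ∀ x ∈ S i,
      pstar x / (∑ y ∈ S i, pstar y) = r x / (∑ y ∈ S i, r y)) ∧
    tsallisDivOn q Finset.univ pstar r =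
      - ∑ i, (∑ x ∈ S i, pstar x) * qlog q ((∑ x ∈ S i, r x) / (∑ x ∈ S i, pstar x)) := by
  have hsum := sum_univ_eq_sum_blocks hdisj hcover
  have hJensen := fun (p : X → ℝ) (hp : ∀ x, 0 < p x) i =>
    sum_mul_qlog_le_and_eq_iff hq0 hq1 (hne i) (fun x _ => hp x) fun x _ => hr x
  obtain ⟨p', hp', hblock, hratio⟩ := exists_proportional_on_blocks hne hdisj hcover hps hr
  have hle := hmin p' hp' (by simp only [hsum, hblock, ← hpssum]) fun m => by
    rw [← hpsa m, hsum, hsum]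
    refine Finset.sum_congr rfl fun i _ => ?_
    obtain ⟨z, hz⟩ := hne i
    have hmass : ∀ p : X → ℝ, ∑ x ∈ S i, p x * w m x = (∑ x ∈ S i, p x) * w m z := fun p => by
      rw [Finset.sum_mul]
      exact Finset.sum_congr rfl fun x hx => by rw [hwconst m i x hx z hz]
    rw [hmass, hmass, hblock]
  have hp'_eq : ∀ i, ∑ x ∈ S i, p' x * qlog q (r x / p' x) =
      (∑ x ∈ S i, pstar x) * qlog q ((∑ x ∈ S i, r x) / ∑ x ∈ S i, pstar x) := fun i => by
    rw [(hJensen p' hp' i).2.2 (by rw [hblock]; exact hratio i), hblock]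
  simp only [tsallisDivOn, hsum, hp'_eq, neg_le_neg_iff] at hle ⊢
  have htotal := (Finset.sum_le_sum fun i _ => (hJensen pstar hps i).1).antisymm hle
  refine ⟨fun i x hx => ?_, congrArg Neg.neg htotal⟩
  have heq := (Finset.sum_eq_sum_iff_of_le fun i _ => (hJensen pstar hps i).1).1 htotal i
    (Finset.mem_univ i)
  have hx_ratio := (hJensen pstar hps i).2.1 heq x hx
  have hpos : ∀ {f : X → ℝ}, (∀ x, 0 < f x) → 0 < ∑ y ∈ S i, f y := fun hf =>
    Finset.sum_pos (fun x _ => hf x) (hne i)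
  rw [div_eq_div_iff (hps x).ne' (hpos hps).ne'] at hx_ratio
  rw [div_eq_div_iff (hpos hps).ne' (hpos hr).ne']
  linarith
end
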